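/- Let W³ = (1/√3)(e₀₀₁ + e₀₁₀ + e₁₀₀) ∈ ℂ⁸ and let ρ = (3/4)|W³⟩⟨W³| + (1/4)|e₀₀₀⟩⟨e₀₀₀| (an 8×8 density matrix). Then there exist orthonormal bases (a₀,a₁,a₂) and (b₀,b₁,b₂) of ℝ³ and vectors c₀,c₁,c₂ ∈ ℝ³ with ‖c_i‖ ≤ 1 such that, with A_i = a_i·σ, B_i = b_i·σ, C_i = c_i·σ and D₀ = A₀⊗B₀ + A₁⊗B₁ + A₂⊗B₂, D₁ = A₀⊗B₂ − A₁⊗B₀ + A₂⊗B₁, D₂ = A₀⊗B₁ − A₁⊗B₂ + A₂⊗B₀, one has |Re Tr((D₀⊗C₀ + D₁⊗C₁ + D₂⊗C₂) * ρ)| > 3. -/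

import Mathlib

open Matrix Kronecker

/-- The Pauli matrices. -/
noncomputable def pauli1 : Matrix (Fin 2) (Fin 2) ℂ := !![0, 1; 1, 0]
noncomputable def pauli2 : Matrix (Fin 2) (Fin 2) ℂ := !![0, -Complex.I; Complex.I, 0]
noncomputable def pauli3 : Matrix (Fin 2) (Fin 2) ℂ := !![1, 0; 0, -1]

/-- `n·σ` for `n ∈ ℝ³`. -/
noncomputable def dotSigma (n : EuclideanSpace ℝ (Fin 3)) : Matrix (Fin 2) (Fin 2) ℂ :=
  (n 0 : ℂ) • pauli1 + (n 1 : ℂ) • pauli2 + (n 2 : ℂ) • pauli3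

/-- Standard basis vector `e_{abc}` of `ℂ⁸ = ℂ²⊗ℂ²⊗ℂ²`. -/
def e3 (i j k : Fin 2) : (Fin 2 × Fin 2) × Fin 2 → ℂ :=
  fun q => if q = ((i, j), k) then 1 else 0

/-- The three-qubit W state `W³ = (e₀₀₁ + e₀₁₀ + e₁₀₀)/√3`. -/
noncomputable def W3 : (Fin 2 × Fin 2) × Fin 2 → ℂ :=
  (Real.sqrt 3 : ℂ)⁻¹ • (e3 0 0 1 + e3 0 1 0 + e3 1 0 0)

/-- The three-qubit reduced state of the four-qubit W state:
`ρ = (3/4)|W³⟩⟨W³| + (1/4)|000⟩⟨000|`. -/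
noncomputable def rhoW4red : Matrix ((Fin 2 × Fin 2) × Fin 2) ((Fin 2 × Fin 2) × Fin 2) ℂ :=
  (3 / 4 : ℂ) • vecMulVec W3 (star W3) + (1 / 4 : ℂ) • vecMulVec (e3 0 0 0) (star (e3 0 0 0))

/-- Expectation values in the reduced W state, in terms of matrix entries. -/
theorem trace_mul_rhoW4red (M : Matrix ((Fin 2 × Fin 2) × Fin 2) ((Fin 2 × Fin 2) × Fin 2) ℂ) :
    (M * rhoW4red).trace = (1 / 4 : ℂ) *
      (M ((0, 0), 1) ((0, 0), 1) + M ((0, 0), 1) ((0, 1), 0) + M ((0, 0), 1) ((1, 0), 0)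
        + M ((0, 1), 0) ((0, 0), 1) + M ((0, 1), 0) ((0, 1), 0) + M ((0, 1), 0) ((1, 0), 0)
        + M ((1, 0), 0) ((0, 0), 1) + M ((1, 0), 0) ((0, 1), 0) + M ((1, 0), 0) ((1, 0), 0)
        + M ((0, 0), 0) ((0, 0), 0)) := by
  have h3 : ((Real.sqrt 3 : ℂ)⁻¹) * (Real.sqrt 3 : ℂ)⁻¹ = 1 / 3 := by
    rw [← mul_inv, ← Complex.ofReal_mul, Real.mul_self_sqrt (by norm_num)]
    norm_num
  rw [rhoW4red, Matrix.mul_add, Matrix.mul_smul, Matrix.mul_smul, trace_add, trace_smul,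
    trace_smul, mul_vecMulVec, mul_vecMulVec, trace_vecMulVec, trace_vecMulVec]
  simp [W3, e3, dotProduct, mulVec, Fintype.sum_prod_type, Fin.sum_univ_two]
  linear_combination (3 / 4 : ℂ) *
      (M ((0, 0), 1) ((0, 0), 1) + M ((0, 0), 1) ((0, 1), 0) + M ((0, 0), 1) ((1, 0), 0)
        + M ((0, 1), 0) ((0, 0), 1) + M ((0, 1), 0) ((0, 1), 0) + M ((0, 1), 0) ((1, 0), 0)
        + M ((1, 0), 0) ((0, 0), 1) + M ((1, 0), 0) ((0, 1), 0) + M ((1, 0), 0) ((1, 0), 0)) * h3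

/-- Correlation functions of the reduced W state. -/
theorem re_trace_dotSigma_mul_rhoW4red (a b c : EuclideanSpace ℝ (Fin 3)) :
    (((dotSigma a ⊗ₖ dotSigma b) ⊗ₖ dotSigma c) * rhoW4red).trace.re =
      (1 / 2 : ℝ) * ((a 0 * b 0 + a 1 * b 1) * c 2 + (a 0 * b 2 + a 2 * b 0) * c 0
        + (a 1 * b 2 + a 2 * b 1) * c 1 - a 2 * b 2 * c 2) := by
  rw [trace_mul_rhoW4red]
  simp [dotSigma, pauli1, pauli2, pauli3]
  ring

theorem sub_kronecker {R l m n p : Type*} [NonUnitalNonAssocRing R]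
    (A B : Matrix l m R) (C : Matrix n p R) : (A - B) ⊗ₖ C = A ⊗ₖ C - B ⊗ₖ C := by
  ext
  simp [sub_mul]

theorem orthonormal_fin_three {v : Fin 3 → EuclideanSpace ℝ (Fin 3)}
    (h : ∀ i j, v i 0 * v j 0 + v i 1 * v j 1 + v i 2 * v j 2 = if i = j then 1 else 0) :
    Orthonormal ℝ v := by
  rw [orthonormal_iff_ite]
  intro i j
  rw [← h i j]
  simp [PiLp.inner_apply, Fin.sum_univ_three, mul_comm]

/-- the reduced state `(3/4)|W³⟩⟨W³| + (1/4)|000⟩⟨000|` of the four-qubit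
W state violates the three-setting genuine steering inequality: there exist orthonormal
bases `a, b` of `ℝ³` and vectors `c i` with `‖c i‖ ≤ 1` such that
`|Re Tr((D₀⊗C₀ + D₁⊗C₁ + D₂⊗C₂) ρ)| > 3`. -/
theorem persistency_stmt6 :
    ∃ (a b c : Fin 3 → EuclideanSpace ℝ (Fin 3)),
      Orthonormal ℝ a ∧ Orthonormal ℝ b ∧ (∀ i, ‖c i‖ ≤ 1) ∧
      |((((dotSigma (a 0) ⊗ₖ dotSigma (b 0) + dotSigma (a 1) ⊗ₖ dotSigma (b 1)
            + dotSigma (a 2) ⊗ₖ dotSigma (b 2)) ⊗ₖ dotSigma (c 0)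
          + (dotSigma (a 0) ⊗ₖ dotSigma (b 2) - dotSigma (a 1) ⊗ₖ dotSigma (b 0)
            + dotSigma (a 2) ⊗ₖ dotSigma (b 1)) ⊗ₖ dotSigma (c 1)
          + (dotSigma (a 0) ⊗ₖ dotSigma (b 1) - dotSigma (a 1) ⊗ₖ dotSigma (b 2)
            + dotSigma (a 2) ⊗ₖ dotSigma (b 0)) ⊗ₖ dotSigma (c 2)) * rhoW4red).trace.re)|
        > 3 := by
  refine ⟨![!₂[1 / 3, -2 / 3, -2 / 3], !₂[-2 / 3, 1 / 3, -2 / 3], !₂[2 / 3, 2 / 3, -1 / 3]],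
    ![!₂[1 / 3, 2 / 3, -2 / 3], !₂[2 / 3, 1 / 3, 2 / 3], !₂[2 / 3, -2 / 3, -1 / 3]],
    ![!₂[-1, 0, 0], !₂[-1 / 3, 2 / 3, 2 / 3], !₂[-1 / 3, -2 / 3, 2 / 3]],
    orthonormal_fin_three ?_, orthonormal_fin_three ?_, ?_, ?_⟩
  · intro i j
    fin_cases i <;> fin_cases j <;> simp <;> norm_num
  · intro i j
    fin_cases i <;> fin_cases j <;> simp <;> norm_num
  · intro i
    rw [EuclideanSpace.norm_eq, Real.sqrt_le_one]
    fin_cases i <;> simp [Fin.sum_univ_three] <;> norm_num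
  · simp only [add_kronecker, sub_kronecker, Matrix.add_mul, Matrix.sub_mul, trace_add,
      trace_sub, Complex.add_re, Complex.sub_re, re_trace_dotSigma_mul_rhoW4red]
    simp
    norm_num
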